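/- (Consensus halving with m cuts / Hobby–Rice theorem.) Let μ_1, …, μ_m be probability measures on the interval [0,1], each absolutely continuous with respect to Lebesgue measure. Then there exist points 0 = t_0 ≤ t_1 ≤ ⋯ ≤ t_m ≤ t_{m+1} = 1 and signs ε_1, …, ε_{m+1} ∈ {−1, +1} such that for every i ∈ {1,…,m}, the sum over j ∈ {1,…,m+1} of ε_j · μ_i([t_{j−1}, t_j]) equals 0. In other words, the interval [0,1] can be partitioned using at most m cuts into two pieces I^+ (the union of the subintervals with ε_j = +1) and I^− (the union of those with ε_j = −1) such that μ_i(I^+) = μ_i(I^−) = 1/2 for every i. -/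

import Mathlib

open MeasureTheory

open Finset

section AlternatingLabels

/-- A set of signed labels is alternating with initial sign `e` if, sorting the labels by absolute
value, the signs are `e, !e, e, …`. -/
def IsAlternating (e : Bool) (L : Finset (ℕ × Bool)) : Prop :=
  ∀ p ∈ L, p.2 = xor e (Nat.bodd (#{q ∈ L | q.1 < p.1}))

lemma isAlternating_empty (e : Bool) : IsAlternating e ∅ := by
  simp [IsAlternating]

lemma isAlternating_insert {e : Bool} {p : ℕ × Bool} {L : Finset (ℕ × Bool)}
    (hp : ∀ q ∈ L, q.1 < p.1) :
    IsAlternating e (insert p L) ↔ IsAlternating e L ∧ p.2 = xor e (Nat.bodd #L) := by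
  have h1 : ({q ∈ insert p L | q.1 < p.1} : Finset (ℕ × Bool)) = L := by
    ext q
    simp only [mem_filter, mem_insert]
    constructor
    · rintro ⟨rfl | h, h'⟩
      · exact absurd h' (lt_irrefl _)
      · exact h
    · exact fun h => ⟨Or.inr h, hp q h⟩
  have h2 : ∀ r ∈ L, ({q ∈ insert p L | q.1 < r.1} : Finset (ℕ × Bool)) =
      {q ∈ L | q.1 < r.1} := by
    intro r hr
    rw [filter_insert, if_neg (hp r hr).not_gt]
  simp only [IsAlternating, forall_mem_insert, h1]
  constructor
  · rintro ⟨h, h'⟩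
    exact ⟨fun r hr => by rw [h' r hr, h2 r hr], h⟩
  · rintro ⟨h, h'⟩
    exact ⟨h', fun r hr => by rw [h r hr, h2 r hr]⟩

open Classical in
lemma sum_isAlternating_erase (L : Finset (ℕ × Bool))
    (hL : Set.InjOn Prod.fst (L : Set (ℕ × Bool))) :
    ∑ p ∈ L, (if IsAlternating true (L.erase p) then 1 else 0 : ZMod 2) =
      (if IsAlternating true L then 1 else 0) + (if IsAlternating false L then 1 else 0) := by
  revert hL
  refine Finset.induction_on_max_value Prod.fst L ?_ ?_
  · intro _
    simp only [sum_empty, isAlternating_empty, if_true]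
    decide
  · intro p L hp hmax ih hL
    have hlt : ∀ q ∈ L, q.1 < p.1 := fun q hq =>
      lt_of_le_of_ne (hmax q hq) fun h =>
        hp (hL (mem_coe.2 (mem_insert_of_mem hq)) (mem_coe.2 (mem_insert_self p L)) h ▸ hq)
    have ih := ih (hL.mono (by simp))
    have hterm : ∀ q ∈ L, (if IsAlternating true ((insert p L).erase q) then 1 else 0 : ZMod 2) =
        (if IsAlternating true (L.erase q) then 1 else 0) *
          (if p.2 = Nat.bodd #L then 1 else 0) := by
      intro q hq
      have hne : p ≠ q := fun h => hp (h ▸ hq)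
      have hb : xor true (Nat.bodd #(L.erase q)) = Nat.bodd #L := by
        rw [← card_erase_add_one hq, Nat.bodd_succ, Bool.true_xor]
      rw [erase_insert_of_ne hne,
        isAlternating_insert fun r hr => hlt r (mem_of_mem_erase hr), hb]
      by_cases h1 : IsAlternating true (L.erase q) <;> by_cases h2 : p.2 = Nat.bodd #L <;>
        simp [h1, h2]
    rw [sum_insert hp, erase_insert hp, sum_congr rfl hterm, ← sum_mul, ih,
      isAlternating_insert hlt, isAlternating_insert hlt]
    cases hb : p.2 <;> cases hn : Nat.bodd #L <;>
      by_cases h1 : IsAlternating true L <;> by_cases h2 : IsAlternating false L <;>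
      simp [h1, h2] <;> decide

open Classical in
/-- The mod 2 indicator that the labels `l i`, `i ∈ T`, are distinct and alternating. -/
noncomputable def altIndicator {ι : Type*} (e : Bool) (T : Finset ι) (l : ι → ℕ × Bool) : ZMod 2 :=
  if #(T.image l) = #T ∧ IsAlternating e (T.image l) then 1 else 0

lemma altIndicator_congr {ι : Type*} {e : Bool} {T : Finset ι} {l l' : ι → ℕ × Bool}
    (h : ∀ i ∈ T, l i = l' i) : altIndicator e T l = altIndicator e T l' := by
  rw [altIndicator, altIndicator, image_congr h]

lemma altIndicator_map {ι κ : Type*} (e : Bool) (T : Finset ι) (g : ι ↪ κ) (l : κ → ℕ × Bool) :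
    altIndicator e (T.map g) l = altIndicator e T (l ∘ g) := by
  classical
  rw [altIndicator, altIndicator, map_eq_image, image_image, ← map_eq_image, card_map]

lemma isAlternating_image_neg (e : Bool) (L : Finset (ℕ × Bool)) :
    IsAlternating e (L.image (Prod.map id not)) ↔ IsAlternating (!e) L := by
  have hinj : Function.Injective (Prod.map id not : ℕ × Bool → ℕ × Bool) :=
    Function.injective_id.prodMap Bool.not_injective
  simp only [IsAlternating, forall_mem_image, filter_image, card_image_of_injective _ hinj,
    Prod.map_fst, Prod.map_snd, id]
  refine forall₂_congr fun p _ => ?_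
  cases p.2 <;> cases e <;> simp

lemma altIndicator_neg {ι : Type*} (e : Bool) (T : Finset ι) (l : ι → ℕ × Bool) :
    altIndicator e T (fun i => Prod.map id not (l i)) = altIndicator (!e) T l := by
  classical
  have hinj : Function.Injective (Prod.map id not : ℕ × Bool → ℕ × Bool) :=
    Function.injective_id.prodMap Bool.not_injective
  have : T.image (fun i => Prod.map id not (l i)) = (T.image l).image (Prod.map id not) := by
    rw [image_image]; rfl
  rw [altIndicator, altIndicator, this, isAlternating_image_neg, card_image_of_injective _ hinj]

/-- The coboundary of the alternation cochain. -/
lemma sum_altIndicator_erase {ι : Type*} [DecidableEq ι] (T : Finset ι) (l : ι → ℕ × Bool)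
    (hl : ∀ i ∈ T, ∀ j ∈ T, (l i).1 = (l j).1 → l i = l j) :
    ∑ i ∈ T, altIndicator true (T.erase i) l =
      altIndicator true T l + altIndicator false T l := by
  classical
  by_cases hinj : Set.InjOn l (T : Set ι)
  · have herase : ∀ i ∈ T, (T.erase i).image l = (T.image l).erase (l i) := by
      intro i hi
      ext p
      simp only [mem_image, mem_erase]
      constructor
      · rintro ⟨j, ⟨hji, hj⟩, rfl⟩
        exact ⟨fun h => hji (hinj hj hi h), j, hj, rfl⟩
      · rintro ⟨hp, j, hj, rfl⟩
        exact ⟨j, ⟨fun h => hp (h ▸ rfl), hj⟩, rfl⟩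
    have hc : #(T.image l) = #T := card_image_of_injOn hinj
    have hfst : Set.InjOn Prod.fst ((T.image l : Finset (ℕ × Bool)) : Set (ℕ × Bool)) := by
      intro p hp q hq h
      obtain ⟨i, hi, rfl⟩ := mem_image.1 (mem_coe.1 hp)
      obtain ⟨j, hj, rfl⟩ := mem_image.1 (mem_coe.1 hq)
      exact hl i hi j hj h
    have := sum_isAlternating_erase _ hfst
    rw [sum_image hinj] at this
    simp only [altIndicator, hc, true_and]
    rw [← this]
    refine sum_congr rfl fun i hi => ?_
    rw [herase i hi, card_erase_of_mem (mem_image_of_mem l hi), card_erase_of_mem hi, hc]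
    simp
  · have hz : ∀ (e : Bool) (S : Finset ι), ¬ Set.InjOn l (S : Set ι) → altIndicator e S l = 0 := by
      intro e S hS
      rw [altIndicator, if_neg fun h => hS (card_image_iff.1 h.1)]
    rw [hz _ _ hinj, hz _ _ hinj, add_zero]
    simp only [Set.InjOn, not_forall, mem_coe] at hinj
    obtain ⟨x, hx, y, hy, hxy, hne⟩ := hinj
    rw [← add_sum_erase T _ hx, ← add_sum_erase (T.erase x) _ (mem_erase.2 ⟨Ne.symm hne, hy⟩),
      sum_eq_zero, add_zero]
    · have himg : (T.erase x).image l = (T.erase y).image l := by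
        ext p
        simp only [mem_image, mem_erase]
        constructor
        · rintro ⟨i, ⟨hi, hiT⟩, rfl⟩
          by_cases h : i = y
          · exact ⟨x, ⟨hne, hx⟩, h ▸ hxy⟩
          · exact ⟨i, ⟨h, hiT⟩, rfl⟩
        · rintro ⟨i, ⟨hi, hiT⟩, rfl⟩
          by_cases h : i = x
          · exact ⟨y, ⟨Ne.symm hne, hy⟩, h ▸ hxy.symm⟩
          · exact ⟨i, ⟨h, hiT⟩, rfl⟩
      rw [altIndicator, altIndicator, himg, card_erase_of_mem hx, card_erase_of_mem hy]
      exact CharTwo.add_self_eq_zero _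
    · intro i hi
      simp only [mem_erase] at hi
      refine hz _ _ fun h => hne (h ?_ ?_ hxy)
      · simpa using ⟨hx, Ne.symm hi.2.1⟩
      · simpa using ⟨hy, Ne.symm hi.1⟩

end AlternatingLabels

section OctahedralTucker

/-- A nonzero sign vector on `{0, …, N - 1}`, recorded as the set of its signed coordinates. -/
def IsSignVector (N : ℕ) (X : Finset (ℕ × Bool)) : Prop :=
  X.Nonempty ∧ Set.InjOn Prod.fst (X : Set (ℕ × Bool)) ∧ ∀ p ∈ X, p.1 < N

/-- Maximal chains of sign vectors on `{0, …, n - 1}`, recorded by the order in which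
signed coordinates are added. -/
def signFlags (n : ℕ) : Finset (Fin n → ℕ × Bool) :=
  {f ∈ Fintype.piFinset fun _ => range n ×ˢ univ | Function.Injective fun i => (f i).1}

/-- The `i`-th sign vector in the chain of a flag. -/
def flagPrefix {n : ℕ} (f : Fin n → ℕ × Bool) (i : Fin n) : Finset (ℕ × Bool) :=
  (Iic i).image f

lemma mem_signFlags {n : ℕ} {f : Fin n → ℕ × Bool} :
    f ∈ signFlags n ↔ (∀ i, (f i).1 < n) ∧ Function.Injective fun i => (f i).1 := by
  simp [signFlags, Fintype.mem_piFinset, mem_product]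

lemma isSignVector_flagPrefix {n N : ℕ} (hn : n ≤ N) {f : Fin n → ℕ × Bool}
    (hf : f ∈ signFlags n) (i : Fin n) : IsSignVector N (flagPrefix f i) := by
  rw [mem_signFlags] at hf
  refine ⟨⟨f i, mem_image_of_mem f (mem_Iic.2 le_rfl)⟩, ?_, ?_⟩
  · intro p hp q hq h
    obtain ⟨j, -, rfl⟩ := mem_image.1 (mem_coe.1 hp)
    obtain ⟨k, -, rfl⟩ := mem_image.1 (mem_coe.1 hq)
    rw [hf.2 h]
  · intro p hp
    obtain ⟨j, -, rfl⟩ := mem_image.1 hp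
    exact (hf.1 j).trans_le hn

lemma flagPrefix_mono {n : ℕ} (f : Fin n → ℕ × Bool) : Monotone (flagPrefix f) :=
  fun _ _ h => image_subset_image (Iic_subset_Iic.2 h)

lemma flagPrefix_congr {n : ℕ} {f g : Fin n → ℕ × Bool} {i : Fin n} (h : ∀ j ≤ i, f j = g j) :
    flagPrefix f i = flagPrefix g i :=
  image_congr fun j hj => h j (mem_Iic.1 hj)

lemma flagPrefix_comp_swap {n : ℕ} (f : Fin (n + 1) → ℕ × Bool) (k : Fin n) {j : Fin (n + 1)}
    (hj : j ≠ k.castSucc) :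
    flagPrefix (f ∘ Equiv.swap k.castSucc k.succ) j = flagPrefix f j := by
  have h : (Iic j).image (Equiv.swap k.castSucc k.succ) = Iic j := by
    refine eq_of_subset_of_card_le ?_ (card_image_of_injective _ (Equiv.injective _)).ge
    intro x hx
    obtain ⟨y, hy, rfl⟩ := mem_image.1 hx
    rw [mem_Iic] at hy ⊢
    rw [Equiv.swap_apply_def]
    simp only [Fin.le_def, Fin.ext_iff, ne_eq, Fin.val_castSucc, Fin.val_succ] at hy hj ⊢
    split_ifs <;> simp <;> omega
  rw [flagPrefix, ← image_image, h, flagPrefix]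

lemma flagPrefix_castSucc {n : ℕ} (f : Fin (n + 1) → ℕ × Bool) (k : Fin n) :
    flagPrefix f k.castSucc = flagPrefix (fun i => f i.castSucc) k := by
  ext p
  simp only [flagPrefix, mem_image, mem_Iic]
  constructor
  · rintro ⟨i, hi, rfl⟩
    exact ⟨⟨i, (Fin.le_def.1 hi).trans_lt k.2⟩, hi, rfl⟩
  · rintro ⟨i, hi, rfl⟩
    exact ⟨i.castSucc, Fin.castSucc_le_castSucc_iff.2 hi, rfl⟩

lemma flagPrefix_neg {n : ℕ} (f : Fin n → ℕ × Bool) (i : Fin n) :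
    flagPrefix (fun j => Prod.map id not (f j)) i = (flagPrefix f i).image (Prod.map id not) := by
  rw [flagPrefix, flagPrefix, image_image]; rfl

lemma prodMap_id_not_involutive :
    Function.Involutive (Prod.map id not : ℕ × Bool → ℕ × Bool) := fun p => by
  simp [Prod.map]

lemma neg_mem_signFlags {n : ℕ} {f : Fin n → ℕ × Bool} (hf : f ∈ signFlags n) :
    (fun j => Prod.map id not (f j)) ∈ signFlags n := by
  simpa [mem_signFlags] using hf

lemma exists_fst_eq_of_mem_signFlags {n : ℕ} {f : Fin n → ℕ × Bool} (hf : f ∈ signFlags n)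
    {k : ℕ} (hk : k < n) : ∃ i, (f i).1 = k := by
  rw [mem_signFlags] at hf
  have hinj : Function.Injective fun i : Fin n => (⟨(f i).1, hf.1 i⟩ : Fin n) := fun i j h =>
    hf.2 (Fin.mk.inj_iff.1 h)
  obtain ⟨i, hi⟩ := Finite.surjective_of_injective hinj ⟨k, hk⟩
  exact ⟨i, congrArg Fin.val hi⟩

/-- The flags whose last vector lies in the upper hemisphere. -/
def upperFlags (n : ℕ) : Finset (Fin (n + 1) → ℕ × Bool) :=
  {f ∈ signFlags (n + 1) | ∃ i, f i = (n, true)}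

lemma sum_signFlags_succ {M : Type*} [AddCommMonoid M] (n : ℕ)
    (F : (Fin (n + 1) → ℕ × Bool) → M) :
    ∑ f ∈ signFlags (n + 1), F f =
      ∑ f ∈ upperFlags n, (F f + F fun j => Prod.map id not (f j)) := by
  have hneg : ∑ f ∈ signFlags (n + 1) with ¬ ∃ i, f i = (n, true), F f =
      ∑ f ∈ upperFlags n, F fun j => Prod.map id not (f j) := by
    refine sum_nbij' (fun f j => Prod.map id not (f j)) (fun f j => Prod.map id not (f j))
      ?_ ?_ ?_ ?_ ?_
    · intro f hf
      rw [mem_filter] at hf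
      obtain ⟨i, hi⟩ := exists_fst_eq_of_mem_signFlags hf.1 n.lt_succ_self
      refine mem_filter.2 ⟨neg_mem_signFlags hf.1, i, ?_⟩
      have : (f i).2 ≠ true := fun h => hf.2 ⟨i, Prod.ext hi h⟩
      exact Prod.ext hi (by simpa using this)
    · intro f hf
      obtain ⟨hf, i, hi⟩ := mem_filter.1 hf
      refine mem_filter.2 ⟨neg_mem_signFlags hf, ?_⟩
      rintro ⟨j, hj⟩
      have h1 : (f j).1 = n := congrArg Prod.fst hj
      have h2 : j = i := (mem_signFlags.1 hf).2 (h1.trans (congrArg Prod.fst hi).symm)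
      subst h2
      have := congrArg Prod.snd hi
      have := congrArg Prod.snd hj
      simp_all
    · intro f _
      funext j
      exact prodMap_id_not_involutive _
    · intro f _
      funext j
      exact prodMap_id_not_involutive _
    · intro f _
      congr 1
      funext j
      exact (prodMap_id_not_involutive _).symm
  rw [← sum_filter_add_sum_filter_not _ (fun f => ∃ i, f i = (n, true)), hneg, sum_add_distrib]
  rfl

variable {N : ℕ} {lam : Finset (ℕ × Bool) → ℕ × Bool}

lemma sum_upperFlags_erase_castSucc (n : ℕ) (k : Fin n) :
    ∑ f ∈ upperFlags n,
      altIndicator true (univ.erase k.castSucc) (fun i => lam (flagPrefix f i)) = 0 := by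
  refine sum_involution (fun f _ => f ∘ Equiv.swap k.castSucc k.succ) ?_ ?_ ?_ ?_
  · intro f _
    refine (congrArg₂ _ (altIndicator_congr ?_) rfl).trans (CharTwo.add_self_eq_zero _)
    exact fun i hi => congrArg lam (flagPrefix_comp_swap f k (ne_of_mem_erase hi)).symm
  · intro f hf _ h
    have h1 := congrArg Prod.fst (congrFun h k.castSucc)
    simp only [Function.comp_apply, Equiv.swap_apply_left] at h1
    have := (mem_signFlags.1 (mem_filter.1 hf).1).2 h1
    simp [Fin.ext_iff] at this
  · intro f hf
    obtain ⟨hf, i, hi⟩ := mem_filter.1 hf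
    rw [mem_signFlags] at hf
    refine mem_filter.2 ⟨mem_signFlags.2 ⟨fun j => hf.1 _, hf.2.comp (Equiv.injective _)⟩,
      Equiv.swap k.castSucc k.succ i, ?_⟩
    simp [hi]
  · intro f _
    funext j
    simp

lemma sum_upperFlags_erase_last (n : ℕ) :
    ∑ f ∈ upperFlags n,
      altIndicator true (univ.erase (Fin.last n)) (fun i => lam (flagPrefix f i)) =
    ∑ f ∈ signFlags n, altIndicator true univ (fun i => lam (flagPrefix f i)) := by
  rw [← sum_filter_add_sum_filter_not _ (fun f => f (Fin.last n) = (n, true))]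
  have hzero : ∑ f ∈ upperFlags n with ¬ f (Fin.last n) = (n, true),
      altIndicator true (univ.erase (Fin.last n)) (fun i => lam (flagPrefix f i)) = 0 := by
    refine sum_involution
      (fun f _ => Function.update f (Fin.last n) (Prod.map id not (f (Fin.last n)))) ?_ ?_ ?_ ?_
    · intro f _
      refine (congrArg₂ _ (altIndicator_congr ?_) rfl).trans (CharTwo.add_self_eq_zero _)
      intro i hi
      refine congrArg lam (flagPrefix_congr fun j hj => ?_)
      refine (Function.update_of_ne ?_ _ _).symm
      rintro rfl
      exact ne_of_mem_erase hi (Fin.last_le_iff.1 hj)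
    · intro f _ _ h
      have := congrArg Prod.snd (congrFun h (Fin.last n))
      simp at this
    · intro f hf
      obtain ⟨hf, hlast⟩ := mem_filter.1 hf
      obtain ⟨hf, i, hi⟩ := mem_filter.1 hf
      have hfst : (fun j => (Function.update f (Fin.last n)
          (Prod.map id not (f (Fin.last n))) j).1) = fun j => (f j).1 := by
        funext j
        by_cases h : j = Fin.last n
        · subst h; simp
        · rw [Function.update_of_ne h]
      have hne : i ≠ Fin.last n := by rintro rfl; exact hlast hi
      rw [mem_signFlags] at hf
      refine mem_filter.2 ⟨mem_filter.2 ⟨mem_signFlags.2 ⟨fun j => ?_, ?_⟩, i, ?_⟩, ?_⟩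
      · exact (congrFun hfst j).trans_lt (hf.1 j)
      · rw [hfst]; exact hf.2
      · rw [Function.update_of_ne hne, hi]
      · intro h
        have h1 := congrArg Prod.fst h
        simp only [Function.update_self, Prod.map_fst, id] at h1
        exact hne (hf.2 ((congrArg Prod.fst hi).trans h1.symm))
    · intro f _
      simp [prodMap_id_not_involutive _]
  rw [hzero, add_zero]
  refine sum_nbij' (fun f i => f i.castSucc) (fun f => Fin.snoc (α := fun _ => ℕ × Bool) f (n, true))
    ?_ ?_ ?_ ?_ ?_
  · intro f hf
    obtain ⟨hf, hlast⟩ := mem_filter.1 hf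
    have hf := mem_signFlags.1 (mem_filter.1 hf).1
    refine mem_signFlags.2 ⟨fun i => ?_, hf.2.comp (Fin.castSucc_injective n)⟩
    refine lt_of_le_of_ne (Nat.lt_succ_iff.1 (hf.1 i.castSucc)) fun h => ?_
    have := hf.2 (h.trans (congrArg Prod.fst hlast).symm)
    exact Fin.castSucc_ne_last i this
  · intro f hf
    rw [mem_signFlags] at hf
    refine mem_filter.2 ⟨mem_filter.2 ⟨mem_signFlags.2 ⟨fun i => ?_, ?_⟩, Fin.last n, ?_⟩, ?_⟩
    · induction i using Fin.lastCases with
      | last => simp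
      | cast i => simpa using (hf.1 i).trans n.lt_succ_self
    · intro i j h
      induction i using Fin.lastCases with
      | last =>
        induction j using Fin.lastCases with
        | last => rfl
        | cast j => simp at h; exact absurd h.symm (hf.1 j).ne
      | cast i =>
        induction j using Fin.lastCases with
        | last => simp at h; exact absurd h (hf.1 i).ne
        | cast j => simp at h; rw [hf.2 h]
    · simp
    · simp
  · intro f hf
    rw [← (mem_filter.1 hf).2]
    exact Fin.snoc_init_self f
  · intro f _
    exact Fin.init_snoc _ _
  · intro f _
    have : (univ.erase (Fin.last n)) = (univ : Finset (Fin n)).map Fin.castSuccEmb := by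
      ext i
      induction i using Fin.lastCases <;> simp
    rw [this, altIndicator_map]
    exact altIndicator_congr fun i _ => congrArg lam (flagPrefix_castSucc f i)

/-- Fan's combinatorial lemma on the barycentric subdivision of the octahedral sphere. -/
theorem sum_signFlags_altIndicator
    (hanti : ∀ X, IsSignVector N X → lam (X.image (Prod.map id not)) = Prod.map id not (lam X))
    (hcomp : ∀ X Y, IsSignVector N X → IsSignVector N Y → X ⊆ Y → (lam X).1 = (lam Y).1 →
      lam X = lam Y) (n : ℕ) (hn : n ≤ N) :
    ∑ f ∈ signFlags n, altIndicator true univ (fun i => lam (flagPrefix f i)) = 1 := by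
  induction n with
  | zero =>
    have : signFlags 0 = univ := by
      ext f
      simp only [mem_signFlags, Function.injective_of_subsingleton, mem_univ, and_true, iff_true]
      exact fun i => i.elim0
    simp [this, altIndicator, isAlternating_empty]
  | succ n ih =>
    rw [sum_signFlags_succ, ← ih (by omega), ← sum_upperFlags_erase_last]
    have h : ∀ f ∈ upperFlags n, altIndicator true univ (fun i => lam (flagPrefix f i)) +
        altIndicator true univ
          (fun i => lam (flagPrefix (fun j => Prod.map id not (f j)) i)) =
        ∑ i, altIndicator true (univ.erase i) (fun i => lam (flagPrefix f i)) := by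
      intro f hf
      have hv := isSignVector_flagPrefix hn (mem_filter.1 hf).1
      rw [sum_altIndicator_erase]
      · congr 1
        rw [← Bool.not_true, ← altIndicator_neg]
        refine altIndicator_congr fun i _ => ?_
        rw [flagPrefix_neg, hanti _ (hv i)]
      · intro i _ j _ hij
        rcases le_total i j with h | h
        · exact hcomp _ _ (hv i) (hv j) (flagPrefix_mono f h) hij
        · exact (hcomp _ _ (hv j) (hv i) (flagPrefix_mono f h) hij.symm).symm
    rw [sum_congr rfl h, sum_comm, Fin.sum_univ_castSucc]
    simp [sum_upperFlags_erase_castSucc]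

/-- The octahedral Tucker lemma. -/
theorem octahedral_tucker (hN : 0 < N)
    (hanti : ∀ X, IsSignVector N X → lam (X.image (Prod.map id not)) = Prod.map id not (lam X))
    (hcomp : ∀ X Y, IsSignVector N X → IsSignVector N Y → X ⊆ Y → (lam X).1 = (lam Y).1 →
      lam X = lam Y) :
    ¬ ∀ X, IsSignVector N X → (lam X).1 ∈ Ico 1 N := by
  intro hrange
  have h := sum_signFlags_altIndicator hanti hcomp N le_rfl
  obtain ⟨f, hf, hne⟩ := exists_ne_zero_of_sum_ne_zero (h.trans_ne one_ne_zero)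
  have hv := isSignVector_flagPrefix le_rfl hf
  have hcard : #(univ.image fun i => lam (flagPrefix f i)) = N := by
    by_contra hc
    exact hne (by rw [altIndicator, if_neg]; simp [hc])
  have hinj : Set.InjOn (fun i => lam (flagPrefix f i)) ((univ : Finset (Fin N)) : Set (Fin N)) :=
    card_image_iff.1 (hcard.trans (card_fin N).symm)
  have hle : #(univ : Finset (Fin N)) ≤ #(Ico 1 N) := by
    refine card_le_card_of_injOn (fun i => (lam (flagPrefix f i)).1) (fun i _ => hrange _ (hv i)) ?_
    intro i hi j hj hij
    refine hinj hi hj ?_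
    rcases le_total i j with h | h
    · exact hcomp _ _ (hv i) (hv j) (flagPrefix_mono f h) hij
    · exact (hcomp _ _ (hv j) (hv i) (flagPrefix_mono f h) hij.symm).symm
  rw [card_fin, Nat.card_Ico] at hle
  omega

end OctahedralTucker

section Discrete

/-- The sign sequence starting at `e` which follows `X` on its support and flips elsewhere;
`greedyRun X e (j + 1)` is the sign given to coordinate `j`. -/
def greedyRun (X : Finset (ℕ × Bool)) (e : Bool) : ℕ → Bool
  | 0 => e
  | j + 1 => if (j, true) ∈ X then true else if (j, false) ∈ X then false else !greedyRun X e j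

lemma greedyRun_succ (X : Finset (ℕ × Bool)) (e : Bool) (j : ℕ) : greedyRun X e (j + 1) =
    if (j, true) ∈ X then true else if (j, false) ∈ X then false else !greedyRun X e j := rfl

/-- The number of sign changes among the first `n` steps of a sign sequence. -/
def signChanges (s : ℕ → Bool) (n : ℕ) : ℕ := #{j ∈ range n | s (j + 1) ≠ s j}

@[simp] lemma signChanges_zero (s : ℕ → Bool) : signChanges s 0 = 0 := rfl

lemma signChanges_succ (s : ℕ → Bool) (n : ℕ) :
    signChanges s (n + 1) = signChanges s n + if s (n + 1) ≠ s n then 1 else 0 := by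
  rw [signChanges, signChanges, range_add_one, filter_insert]
  split_ifs <;> simp

lemma signChanges_le (s : ℕ → Bool) (n : ℕ) : signChanges s n ≤ n :=
  (card_filter_le _ _).trans (card_range n).le

lemma signChanges_mono (s : ℕ → Bool) : Monotone (signChanges s) :=
  fun _ _ h => card_le_card (filter_subset_filter _ (range_subset_range.2 h))

lemma eq_xor_bodd_signChanges (s : ℕ → Bool) (n : ℕ) :
    s n = xor (s 0) (Nat.bodd (signChanges s n)) := by
  induction n with
  | zero => simp
  | succ n ih =>
    rw [signChanges_succ]
    by_cases h : s (n + 1) = s n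
    · simp [h, ← ih]
    · rw [if_pos h, Nat.bodd_succ, Bool.xor_not, ← ih]
      exact Bool.eq_not.2 h

lemma IsSignVector.notMem {N : ℕ} {X : Finset (ℕ × Bool)} (hX : IsSignVector N X) {j : ℕ}
    {b : Bool} (h : (j, b) ∈ X) : (j, !b) ∉ X := fun h' => by
  have := congrArg Prod.snd (hX.2.1 (mem_coe.2 h) (mem_coe.2 h') rfl)
  simp at this

lemma mem_image_neg {X : Finset (ℕ × Bool)} {j : ℕ} {b : Bool} :
    (j, b) ∈ X.image (Prod.map id not) ↔ (j, !b) ∈ X := by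
  rw [mem_image]
  constructor
  · rintro ⟨⟨k, c⟩, hp, h⟩
    simp only [Prod.map_apply, id, Prod.mk.injEq] at h
    obtain ⟨rfl, rfl⟩ := h
    simpa using hp
  · intro h
    exact ⟨_, h, by simp⟩

variable {N : ℕ} {X Y : Finset (ℕ × Bool)}

lemma greedyRun_image_neg (hX : IsSignVector N X) (e : Bool) (n : ℕ) :
    greedyRun (X.image (Prod.map id not)) e n = !greedyRun X (!e) n := by
  induction n with
  | zero => simp [greedyRun]
  | succ n ih =>
    have h1 := hX.notMem (j := n) (b := true)
    simp only [greedyRun, mem_image_neg, ih, Bool.not_true, Bool.not_false] at h1 ⊢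
    split_ifs <;> simp_all

lemma signChanges_greedyRun_image_neg (hX : IsSignVector N X) (e : Bool) (n : ℕ) :
    signChanges (greedyRun (X.image (Prod.map id not)) e) n =
      signChanges (greedyRun X (!e)) n := by
  simp [signChanges, greedyRun_image_neg hX]

lemma signChanges_greedyRun_anti_aux (hY : IsSignVector N Y) (h : X ⊆ Y) (e : Bool) (n : ℕ) :
    signChanges (greedyRun Y e) n + (if greedyRun X e n ≠ greedyRun Y e n then 1 else 0) ≤
      signChanges (greedyRun X e) n := by
  induction n with
  | zero => simp [greedyRun]
  | succ n ih =>
    have h1 := hY.notMem (j := n) (b := true)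
    have h2 : (n, true) ∈ X → (n, true) ∈ Y := fun h' => h h'
    have h3 : (n, false) ∈ X → (n, false) ∈ Y := fun h' => h h'
    rw [signChanges_succ, signChanges_succ]
    generalize signChanges (greedyRun Y e) n = cY at *
    generalize signChanges (greedyRun X e) n = cX at *
    have hx := greedyRun_succ X e n
    have hy := greedyRun_succ Y e n
    generalize greedyRun X e (n + 1) = x' at *
    generalize greedyRun Y e (n + 1) = y' at *
    generalize greedyRun Y e n = y at *
    generalize greedyRun X e n = x at *
    by_cases a : (n, true) ∈ X <;> by_cases b : (n, false) ∈ X <;>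
    by_cases c : (n, true) ∈ Y <;> by_cases d : (n, false) ∈ Y <;>
    simp only [a, b, c, d, Bool.not_true, not_true_eq_false, imp_false, forall_true_left,
      false_imp_iff] at h1 h2 h3 <;>
    simp only [a, b, c, d, if_true, if_false] at hx hy <;> subst hx <;>
    subst hy <;> cases x <;> cases y <;> simp at ih ⊢ <;> omega

lemma signChanges_greedyRun_anti (hY : IsSignVector N Y) (h : X ⊆ Y) (e : Bool) (n : ℕ) :
    signChanges (greedyRun Y e) n ≤ signChanges (greedyRun X e) n :=
  (Nat.le_add_right _ _).trans (signChanges_greedyRun_anti_aux hY h e n)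

lemma greedyRun_dichotomy (n : ℕ) :
    (greedyRun X true n ≠ greedyRun X false n ∧
      signChanges (greedyRun X true) n = signChanges (greedyRun X false) n ∧
      ∀ p ∈ X, n ≤ p.1) ∨
    (greedyRun X true n = greedyRun X false n ∧
      signChanges (greedyRun X true) n ≠ signChanges (greedyRun X false) n) := by
  induction n with
  | zero => left; simp [greedyRun]
  | succ n ih =>
    have hp : (n, true) ∉ X → (n, false) ∉ X → (∀ p ∈ X, n ≤ p.1) → ∀ p ∈ X, n + 1 ≤ p.1 := by
      rintro h1 h2 h ⟨k, b⟩ hp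
      refine lt_of_le_of_ne (h _ hp) ?_
      rintro rfl
      cases b <;> contradiction
    rw [signChanges_succ, signChanges_succ]
    have hx := greedyRun_succ X true n
    have hy := greedyRun_succ X false n
    generalize greedyRun X true (n + 1) = x' at *
    generalize greedyRun X false (n + 1) = y' at *
    rcases ih with ⟨h1, h2, h3⟩ | ⟨h1, h2⟩
    · rw [h2]
      generalize greedyRun X true n = x at *
      generalize greedyRun X false n = y at *
      by_cases a : (n, true) ∈ X
      · right; cases x <;> cases y <;> simp_all
      · by_cases b : (n, false) ∈ X
        · right; cases x <;> cases y <;> simp_all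
        · left
          rw [if_neg a, if_neg b] at hx hy
          subst hx hy
          refine ⟨?_, ?_, hp a b h3⟩ <;> cases x <;> cases y <;> simp at h1 ⊢
    · right
      rw [h1, ← hy] at hx
      rw [h1, hx]
      exact ⟨rfl, by simpa using h2⟩

lemma IsSignVector.signChanges_ne (hX : IsSignVector N X) :
    signChanges (greedyRun X true) N ≠ signChanges (greedyRun X false) N := by
  rcases greedyRun_dichotomy (X := X) N with ⟨-, -, h⟩ | ⟨-, h⟩
  · obtain ⟨p, hp⟩ := hX.1
    exact absurd (h p hp) (hX.2.2 p hp).not_ge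
  · exact h

/-- The least number of sign changes of a greedy completion of `X`. -/
def minChanges (N : ℕ) (X : Finset (ℕ × Bool)) : ℕ :=
  min (signChanges (greedyRun X true) N) (signChanges (greedyRun X false) N)

lemma IsSignVector.minChanges_lt (hX : IsSignVector N X) : minChanges N X < N := by
  have h1 := signChanges_le (greedyRun X true) N
  have h2 := signChanges_le (greedyRun X false) N
  have h3 := hX.signChanges_ne
  rw [minChanges]
  omega

variable {m : ℕ} (w : Fin m → ℕ → ℝ)

/-- The mass that `w i` gives to the coordinates of sign `b` in `X`. -/
noncomputable def signMass (N : ℕ) (X : Finset (ℕ × Bool)) (b : Bool) (i : Fin m) : ℝ :=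
  ∑ j ∈ range N with (j, b) ∈ X, w i j

/-- The indices `i` for which one of the signs of `X` has more than half of the mass of `w i`. -/
def majorityIndices (N : ℕ) (X : Finset (ℕ × Bool)) : Set ℕ :=
  {k | ∃ h : k < m, 1 / 2 < signMass w N X true ⟨k, h⟩ ∨ 1 / 2 < signMass w N X false ⟨k, h⟩}

open Classical in
/-- The Tucker labelling for consensus halving. -/
noncomputable def halvingLabel (N : ℕ) (X : Finset (ℕ × Bool)) : ℕ × Bool :=
  if m < minChanges N X then
    (minChanges N X,
      decide (signChanges (greedyRun X true) N < signChanges (greedyRun X false) N))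
  else
    (sInf (majorityIndices w N X) + 1,
      decide (∃ h : sInf (majorityIndices w N X) < m,
        1 / 2 < signMass w N X true ⟨sInf (majorityIndices w N X), h⟩))

variable {w}

lemma signMass_image_neg (b : Bool) (i : Fin m) :
    signMass w N (X.image (Prod.map id not)) b i = signMass w N X (!b) i := by
  simp only [signMass, mem_image_neg]

lemma signMass_mono (hw : ∀ i j, 0 ≤ w i j) (h : X ⊆ Y) (b : Bool) (i : Fin m) :
    signMass w N X b i ≤ signMass w N Y b i :=
  sum_le_sum_of_subset_of_nonneg (monotone_filter_right _ fun _ _ h' => h h') fun j _ _ => hw i j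

lemma IsSignVector.signMass_add_le (hX : IsSignVector N X) (hw : ∀ i j, 0 ≤ w i j) (i : Fin m) :
    signMass w N X true i + signMass w N X false i ≤ ∑ j ∈ range N, w i j := by
  rw [signMass, signMass, ← sum_union]
  · refine sum_le_sum_of_subset_of_nonneg ?_ fun j _ _ => hw i j
    exact union_subset (filter_subset _ _) (filter_subset _ _)
  · exact disjoint_filter.2 fun j _ h => hX.notMem h

lemma minChanges_image_neg (hX : IsSignVector N X) :
    minChanges N (X.image (Prod.map id not)) = minChanges N X := by
  rw [minChanges, minChanges, signChanges_greedyRun_image_neg hX,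
    signChanges_greedyRun_image_neg hX, min_comm]
  rfl

lemma majorityIndices_image_neg :
    majorityIndices w N (X.image (Prod.map id not)) = majorityIndices w N X := by
  ext k
  simp only [majorityIndices, signMass_image_neg, Set.mem_ofPred_eq, Bool.not_true, Bool.not_false]
  exact exists_congr fun _ => or_comm

lemma halvingLabel_image_neg (hw : ∀ i j, 0 ≤ w i j) (hsum : ∀ i, ∑ j ∈ range N, w i j = 1)
    (hX : IsSignVector N X) (hmaj : minChanges N X ≤ m → (majorityIndices w N X).Nonempty) :
    halvingLabel w N (X.image (Prod.map id not)) = Prod.map id not (halvingLabel w N X) := by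
  rw [halvingLabel, halvingLabel, minChanges_image_neg hX, majorityIndices_image_neg]
  split_ifs with h
  · refine Prod.ext rfl ?_
    have := hX.signChanges_ne
    simp only [signChanges_greedyRun_image_neg hX, Prod.map_snd, Bool.not_true, Bool.not_false]
    rw [← decide_not, decide_eq_decide]
    omega
  · refine Prod.ext rfl ?_
    obtain ⟨hk, hk'⟩ := Nat.sInf_mem (hmaj (not_lt.1 h))
    have hle := hX.signMass_add_le hw ⟨_, hk⟩
    rw [hsum] at hle
    simp only [signMass_image_neg, Prod.map_snd, Bool.not_true]
    rw [← decide_not, decide_eq_decide]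
    simp only [hk, exists_true_left]
    constructor
    · intro h1 h2; linarith
    · intro h1; exact hk'.resolve_left h1

lemma halvingLabel_eq_of_subset (hw : ∀ i j, 0 ≤ w i j) (hsum : ∀ i, ∑ j ∈ range N, w i j = 1)
    (hX : IsSignVector N X) (hY : IsSignVector N Y)
    (hmajX : minChanges N X ≤ m → (majorityIndices w N X).Nonempty)
    (hmajY : minChanges N Y ≤ m → (majorityIndices w N Y).Nonempty) (hXY : X ⊆ Y)
    (h : (halvingLabel w N X).1 = (halvingLabel w N Y).1) :
    halvingLabel w N X = halvingLabel w N Y := by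
  refine Prod.ext h ?_
  have hlt : ∀ {Z}, (minChanges N Z ≤ m → (majorityIndices w N Z).Nonempty) →
      minChanges N Z ≤ m → sInf (majorityIndices w N Z) < m := fun hZ hle =>
    (Nat.sInf_mem (hZ hle)).1
  by_cases h1 : m < minChanges N X <;> by_cases h2 : m < minChanges N Y <;>
    simp only [halvingLabel, h1, h2, if_true, if_false] at h ⊢
  · have hXn := hX.signChanges_ne
    have hYn := hY.signChanges_ne
    have ht := signChanges_greedyRun_anti hY hXY true N
    have hf := signChanges_greedyRun_anti hY hXY false N
    rw [minChanges, minChanges] at h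
    rw [decide_eq_decide]
    omega
  · have := hlt hmajY (not_lt.1 h2)
    omega
  · have := hlt hmajX (not_lt.1 h1)
    omega
  · have hk : sInf (majorityIndices w N X) = sInf (majorityIndices w N Y) := by omega
    obtain ⟨hkm, hkX⟩ := Nat.sInf_mem (hmajX (not_lt.1 h1))
    obtain ⟨hkm', hkY⟩ := Nat.sInf_mem (hmajY (not_lt.1 h2))
    rw [decide_eq_decide]
    simp only [hk] at hkm hkX ⊢
    simp only [hkm, exists_true_left]
    have hle := hY.signMass_add_le hw ⟨_, hkm⟩
    have hmt := signMass_mono (N := N) hw hXY true ⟨_, hkm⟩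
    have hmf := signMass_mono (N := N) hw hXY false ⟨_, hkm⟩
    rw [hsum] at hle
    constructor
    · intro h'; linarith
    · intro h'
      rcases hkX with h'' | h''
      · exact h''
      · linarith

lemma exists_minChanges_le (hmN : m < N) (hw : ∀ i j, 0 ≤ w i j)
    (hsum : ∀ i, ∑ j ∈ range N, w i j = 1) :
    ∃ X, IsSignVector N X ∧ minChanges N X ≤ m ∧ ¬ (majorityIndices w N X).Nonempty := by
  by_contra! hcon
  refine octahedral_tucker (lam := halvingLabel w N) (by omega : 0 < N)
    (fun X hX => halvingLabel_image_neg hw hsum hX (hcon X hX))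
    (fun X Y hX hY => halvingLabel_eq_of_subset hw hsum hX hY (hcon X hX) (hcon Y hY)) ?_
  intro X hX
  rw [halvingLabel, mem_Ico]
  split_ifs with h
  · exact ⟨(Nat.zero_le _).trans_lt h, hX.minChanges_lt⟩
  · have := (Nat.sInf_mem (hcon X hX (not_lt.1 h))).1
    dsimp only
    omega

lemma greedyRun_succ_of_mem (hX : IsSignVector N X) (e : Bool) {j : ℕ} {b : Bool}
    (h : (j, b) ∈ X) : greedyRun X e (j + 1) = b := by
  have h1 := hX.notMem h
  cases b <;> simp_all [greedyRun]

/-- Approximate consensus halving of a discretized interval. -/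
theorem exists_discrete_halving (hmN : m < N) (hw : ∀ i j, 0 ≤ w i j)
    (hsum : ∀ i, ∑ j ∈ range N, w i j = 1) {δ : ℝ} (hδ : ∀ i, ∀ j < N, w i j ≤ δ) :
    ∃ s : ℕ → Bool, signChanges s N ≤ m ∧
      ∀ i, |∑ j ∈ range N, (if s (j + 1) then 1 else -1) * w i j| ≤ 2 * m * δ := by
  obtain ⟨X, hX, hmin, hmaj⟩ := exists_minChanges_le hmN hw hsum
  obtain ⟨e, he⟩ : ∃ e, signChanges (greedyRun X e) N ≤ m := by
    rcases min_le_iff.1 hmin with h | h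
    exacts [⟨_, h⟩, ⟨_, h⟩]
  refine ⟨greedyRun X e, he, fun i => ?_⟩
  set Z : Finset ℕ := {j ∈ range N | (j, true) ∉ X ∧ (j, false) ∉ X} with hZ
  have hZcard : #Z ≤ m := by
    refine (card_le_card fun j hj => ?_).trans he
    simp only [hZ, mem_filter] at hj ⊢
    exact ⟨hj.1, by simp [greedyRun, hj.2]⟩
  have hδ0 : 0 ≤ δ := (hw i 0).trans (hδ i 0 (by omega))
  have hZsum : ∑ j ∈ Z, w i j ≤ m * δ := by
    refine (sum_le_card_nsmul Z _ δ fun j hj => hδ i j ?_).trans ?_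
    · exact mem_range.1 (mem_filter.1 hj).1
    · rw [nsmul_eq_mul]
      gcongr
  have hhalf : ∀ b, signMass w N X b i ≤ 1 / 2 := by
    intro b
    by_contra! h
    refine hmaj ⟨i, i.2, ?_⟩
    cases b
    exacts [Or.inr h, Or.inl h]
  have hside : ∀ b, ∑ j ∈ range N with greedyRun X e (j + 1) = b, w i j ≤ 1 / 2 + m * δ := by
    intro b
    refine le_trans ?_ (add_le_add (hhalf b) hZsum)
    refine le_trans (sum_le_sum_of_subset_of_nonneg ?_ fun j _ _ => hw i j)
      (le_of_le_of_eq (le_add_of_nonneg_right (sum_nonneg fun j _ => hw i j))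
        (sum_union_inter (s₁ := {j ∈ range N | (j, b) ∈ X}) (s₂ := Z)))
    intro j hj
    rw [mem_filter] at hj
    rw [mem_union, mem_filter, mem_filter]
    by_contra! hcon
    have hb : (j, b) ∉ X := hcon.1 hj.1
    have hb' : (j, !b) ∈ X := by
      by_contra hb'
      cases b
      · exact hb (hcon.2 hj.1 hb')
      · exact hb' (hcon.2 hj.1 hb)
    have := greedyRun_succ_of_mem hX e hb'
    rw [hj.2] at this
    simp at this
  have hsplit : ∀ u : ℕ → ℝ, ∑ j ∈ range N, u j =
      ∑ j ∈ range N with greedyRun X e (j + 1) = true, u j +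
        ∑ j ∈ range N with greedyRun X e (j + 1) = false, u j := by
    intro u
    rw [← sum_filter_add_sum_filter_not _ (fun j => greedyRun X e (j + 1) = true)]
    simp
  have h1 := hsplit (w i)
  rw [hsum] at h1
  have h2 : ∑ j ∈ range N, (if greedyRun X e (j + 1) then 1 else -1) * w i j =
      ∑ j ∈ range N with greedyRun X e (j + 1) = true, w i j -
        ∑ j ∈ range N with greedyRun X e (j + 1) = false, w i j := by
    rw [hsplit, sub_eq_add_neg, ← sum_neg_distrib]
    congr 1 <;> refine sum_congr rfl fun j hj => ?_ <;> simp [(mem_filter.1 hj).2]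
  have ht := hside true
  have hf := hside false
  rw [h2, abs_le]
  constructor <;> linarith

end Discrete

section Continuous

/-- A lower set of natural numbers is an initial segment. -/
lemma eq_range_card {S : Finset ℕ} (hS : ∀ j ∈ S, ∀ i ≤ j, i ∈ S) : S = range #S := by
  refine eq_of_subset_of_card_le (fun j hj => ?_) (card_range _).le
  have h : range (j + 1) ⊆ S := fun i hi => hS j hj i (Nat.lt_succ_iff.1 (mem_range.1 hi))
  have h := card_le_card h
  rw [card_range] at h
  exact mem_range.2 h

/-- The number of coordinates before the `k`-th sign change of `s`. -/
def cutIndex (s : ℕ → Bool) (N k : ℕ) : ℕ := #{j ∈ range N | signChanges s (j + 1) < k}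

lemma cutIndex_mono (s : ℕ → Bool) (N : ℕ) : Monotone (cutIndex s N) := fun _ _ h =>
  card_le_card (monotone_filter_right _ fun _ _ h' => lt_of_lt_of_le h' h)

@[simp] lemma cutIndex_zero (s : ℕ → Bool) (N : ℕ) : cutIndex s N 0 = 0 := by
  simp [cutIndex]

lemma cutIndex_eq {s : ℕ → Bool} {N k : ℕ} (h : signChanges s N < k) : cutIndex s N k = N := by
  rw [cutIndex, filter_true_of_mem, card_range]
  intro j hj
  exact (signChanges_mono s (Nat.succ_le_of_lt (mem_range.1 hj))).trans_lt h

lemma sum_range_cutIndex (s : ℕ → Bool) (N k : ℕ) (w : ℕ → ℝ) :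
    ∑ j ∈ range (cutIndex s N k), w j =
      ∑ j ∈ range N, if signChanges s (j + 1) < k then w j else 0 := by
  rw [← sum_filter, cutIndex, ← eq_range_card]
  intro j hj i hij
  simp only [mem_filter, mem_range] at hj ⊢
  exact ⟨hij.trans_lt hj.1, (signChanges_mono s (by omega)).trans_lt hj.2⟩

lemma sum_cutIndex_sub {s : ℕ → Bool} {N m : ℕ} (h : signChanges s N ≤ m) (G : ℕ → ℝ) :
    ∑ k : Fin (m + 1), (if xor (s 0) (Nat.bodd k) then (1 : ℝ) else -1) *
        (G (cutIndex s N (k + 1)) - G (cutIndex s N k)) =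
      ∑ j ∈ range N, (if s (j + 1) then 1 else -1) * (G (j + 1) - G j) := by
  have hG : ∀ k, G (cutIndex s N (k + 1)) - G (cutIndex s N k) =
      ∑ j ∈ range N, if signChanges s (j + 1) = k then G (j + 1) - G j else 0 := by
    intro k
    have h1 := sum_range_cutIndex s N (k + 1) (fun j => G (j + 1) - G j)
    have h2 := sum_range_cutIndex s N k (fun j => G (j + 1) - G j)
    rw [sum_range_sub] at h1 h2
    rw [← sub_sub_sub_cancel_right _ _ (G 0), h1, h2, ← sum_sub_distrib]
    refine sum_congr rfl fun j _ => ?_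
    split_ifs <;> first | omega | simp
  simp only [hG, mul_sum]
  rw [sum_comm]
  refine sum_congr rfl fun j hj => ?_
  have hj : signChanges s (j + 1) < m + 1 :=
    Nat.lt_succ_of_le ((signChanges_mono s (Nat.succ_le_of_lt (mem_range.1 hj))).trans h)
  rw [sum_eq_single ⟨signChanges s (j + 1), hj⟩]
  · rw [eq_xor_bodd_signChanges s (j + 1)]
    simp
  · intro k _ hk
    rw [if_neg (c := signChanges s (j + 1) = k) fun h => hk (Fin.ext h.symm), mul_zero]
  · simp

/-- Monotone cut sequences in `[0, 1]` with `m` interior cuts. -/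
def cutSequences (m : ℕ) : Set (Fin (m + 2) → ℝ) :=
  {t | Monotone t ∧ t 0 = 0 ∧ t (Fin.last (m + 1)) = 1}

lemma isCompact_cutSequences (m : ℕ) : IsCompact (cutSequences m) := by
  refine IsCompact.of_isClosed_subset (isCompact_univ_pi fun _ : Fin (m + 2) =>
    isCompact_Icc (a := (0 : ℝ)) (b := 1)) ?_ ?_
  · have : cutSequences m =
        {t | Monotone t} ∩ ({t | t 0 = 0} ∩ {t | t (Fin.last (m + 1)) = 1}) := rfl
    rw [this]
    exact isClosed_monotone.inter ((isClosed_eq (continuous_apply _) continuous_const).inter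
      (isClosed_eq (continuous_apply _) continuous_const))
  · rintro t ⟨hm, h0, h1⟩ i -
    exact ⟨h0 ▸ hm (Fin.zero_le i), h1 ▸ hm (Fin.le_last i)⟩

/-- The signed increment of `F` along the cuts `t` with signs `ε`. -/
def signedIncrement {m : ℕ} (F : ℝ → ℝ) (t : Fin (m + 2) → ℝ) (ε : Fin (m + 1) → Bool) : ℝ :=
  ∑ j, (if ε j then 1 else -1) * (F (t j.succ) - F (t j.castSucc))

variable {m : ℕ} {F : Fin m → ℝ → ℝ}

lemma exists_signedIncrement_le (hmono : ∀ i, Monotone (F i)) (hcont : ∀ i, Continuous (F i))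
    (h01 : ∀ i, F i 1 - F i 0 = 1) {δ : ℝ} (hδ : 0 < δ) :
    ∃ t ∈ cutSequences m, ∃ ε, ∀ i, |signedIncrement (F i) t ε| ≤ 2 * m * δ := by
  have huc : UniformContinuousOn (fun x i => F i x) (Set.Icc (0 : ℝ) 1) :=
    isCompact_Icc.uniformContinuousOn_of_continuous (continuous_pi hcont).continuousOn
  obtain ⟨η, hη, hF⟩ := Metric.uniformContinuousOn_iff.1 huc δ hδ
  obtain ⟨N₀, hN₀⟩ := exists_nat_one_div_lt hη
  set N := max (N₀ + 1) (m + 1) with hN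
  have hNpos : (0 : ℝ) < N := by
    rw [Nat.cast_pos]; omega
  have hNη : 1 / (N : ℝ) < η := by
    refine lt_of_le_of_lt (one_div_le_one_div_of_le (by positivity) ?_) hN₀
    exact_mod_cast le_max_left _ _
  obtain ⟨s, hs, hsum⟩ := exists_discrete_halving (m := m) (N := N) (δ := δ)
    (w := fun i j => F i ((j + 1 : ℕ) / N) - F i (j / N)) (by omega)
    (fun i j => sub_nonneg.2 (hmono i (by gcongr; simp)))
    (fun i => by
      rw [sum_range_sub (fun j : ℕ => F i (j / N)), div_self hNpos.ne', Nat.cast_zero, zero_div]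
      exact h01 i)
    (fun i j hj => by
      have hj' : ((j + 1 : ℕ) : ℝ) ≤ N := by exact_mod_cast hj
      have hj'' : (j : ℝ) ≤ N := by exact_mod_cast hj.le
      have h := hF ((j + 1 : ℕ) / N) ⟨by positivity, div_le_one_of_le₀ hj' hNpos.le⟩
        (j / N) ⟨by positivity, div_le_one_of_le₀ hj'' hNpos.le⟩ (by
          rw [Real.dist_eq, ← sub_div, Nat.cast_succ, add_sub_cancel_left,
            abs_of_pos (by positivity)]
          exact hNη)
      exact (le_abs_self _).trans ((dist_le_pi_dist (fun i => F i ((j + 1 : ℕ) / N))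
        (fun i => F i (j / N)) i).trans h.le))
  refine ⟨fun k => cutIndex s N k / N, ⟨fun i j hij => ?_, ?_, ?_⟩,
    fun k => xor (s 0) (Nat.bodd k), fun i => ?_⟩
  · have := cutIndex_mono s N (Fin.le_def.1 hij)
    dsimp only
    gcongr
  · simp
  · dsimp only
    rw [Fin.val_last, cutIndex_eq (Nat.lt_succ_of_le hs), div_self hNpos.ne']
  · refine le_of_eq_of_le ?_ (hsum i)
    rw [← sum_cutIndex_sub hs (fun j : ℕ => F i (j / N))]
    rfl

theorem exists_signedIncrement_eq_zero (hmono : ∀ i, Monotone (F i))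
    (hcont : ∀ i, Continuous (F i)) (h01 : ∀ i, F i 1 - F i 0 = 1) :
    ∃ t ∈ cutSequences m, ∃ ε, ∀ i, signedIncrement (F i) t ε = 0 := by
  have hK : IsCompact (cutSequences m ×ˢ (Set.univ : Set (Fin (m + 1) → Bool))) :=
    (isCompact_cutSequences m).prod isCompact_univ
  set Ψ : (Fin (m + 2) → ℝ) × (Fin (m + 1) → Bool) → ℝ :=
    fun p => ∑ i, |signedIncrement (F i) p.1 p.2| with hΨ
  have hΨc : Continuous Ψ := by
    refine continuous_finsetSum _ fun i _ => Continuous.abs (continuous_finsetSum _ fun j _ => ?_)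
    have h1 : Continuous fun b : Bool => if b then (1 : ℝ) else -1 :=
      continuous_of_discreteTopology
    have h2 : ∀ k, Continuous fun p : (Fin (m + 2) → ℝ) × (Fin (m + 1) → Bool) => F i (p.1 k) :=
      fun k => (hcont i).comp ((continuous_apply k).comp continuous_fst)
    exact (h1.comp ((continuous_apply j).comp continuous_snd)).mul ((h2 _).sub (h2 _))
  obtain ⟨t₁, ht₁, ε₁, -⟩ := exists_signedIncrement_le hmono hcont h01 one_pos
  obtain ⟨⟨t, ε⟩, ⟨ht, -⟩, hmin⟩ :=
    hK.exists_isMinOn ⟨(t₁, ε₁), ht₁, Set.mem_univ _⟩ hΨc.continuousOn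
  refine ⟨t, ht, ε, fun i => ?_⟩
  have hzero : Ψ (t, ε) ≤ 0 := by
    refine le_of_forall_pos_le_add fun η hη => ?_
    rw [zero_add]
    have hpos : (0 : ℝ) < 2 * m * m + 1 := by positivity
    obtain ⟨t', ht', ε', h'⟩ :=
      exists_signedIncrement_le hmono hcont h01 (div_pos hη hpos)
    refine (hmin (Set.mk_mem_prod ht' (Set.mem_univ ε'))).trans ?_
    refine (sum_le_card_nsmul _ _ _ fun i _ => h' i).trans ?_
    rw [card_fin, nsmul_eq_mul, ← mul_assoc, ← mul_div_assoc, div_le_iff₀ hpos]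
    nlinarith
  have := (sum_eq_zero_iff_of_nonneg fun i _ => abs_nonneg _).1
    (hzero.antisymm (sum_nonneg fun i _ => abs_nonneg _)) i (mem_univ i)
  exact abs_eq_zero.1 this

lemma continuous_cdf (μ : Measure ℝ) [IsProbabilityMeasure μ] [NullSingletonClass μ] :
    Continuous (ProbabilityTheory.cdf μ) := by
  refine continuous_iff_continuousAt.2 fun x => ?_
  rw [(ProbabilityTheory.cdf μ).mono.continuousAt_iff_leftLim_eq_rightLim,
    StieltjesFunction.rightLim_eq]
  have h := (ProbabilityTheory.cdf μ).measure_singleton x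
  rw [ProbabilityTheory.measure_cdf, measure_singleton, eq_comm, ENNReal.ofReal_eq_zero] at h
  exact le_antisymm ((ProbabilityTheory.cdf μ).mono.leftLim_le le_rfl) (by linarith)

lemma measure_Icc_toReal_eq_cdf_sub (μ : Measure ℝ) [IsProbabilityMeasure μ] [NullSingletonClass μ]
    {a b : ℝ} (hab : a ≤ b) :
    (μ (Set.Icc a b)).toReal = ProbabilityTheory.cdf μ b - ProbabilityTheory.cdf μ a := by
  rw [← measure_congr Ioc_ae_eq_Icc, ← ENNReal.toReal_ofReal
    (sub_nonneg.2 ((ProbabilityTheory.cdf μ).mono hab)), ← StieltjesFunction.measure_Ioc,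
    ProbabilityTheory.measure_cdf]

end Continuous

/-- The Hobby–Rice theorem / consensus halving with `m` cuts: given `m`
probability measures on `[0,1]` absolutely continuous with respect to Lebesgue
measure, the interval can be cut at points `0 = t₀ ≤ t₁ ≤ ⋯ ≤ t_{m+1} = 1`
and the resulting subintervals signed by `ε_j ∈ {±1}` so that each measure gives
equal mass to the positive and the negative piece. -/
theorem consensus_halving (m : ℕ) (μ : Fin m → Measure ℝ)
    (hprob : ∀ i, IsProbabilityMeasure (μ i))
    (hsupp : ∀ i, μ i (Set.Icc (0 : ℝ) 1) = 1)
    (hac : ∀ i, μ i ≪ volume) :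
    ∃ t : Fin (m + 2) → ℝ, Monotone t ∧ t 0 = 0 ∧ t (Fin.last (m + 1)) = 1 ∧
      ∃ ε : Fin (m + 1) → ℝ, (∀ j, ε j = 1 ∨ ε j = -1) ∧
        ∀ i, ∑ j : Fin (m + 1),
          ε j * (μ i (Set.Icc (t j.castSucc) (t j.succ))).toReal = 0 := by
  have hna : ∀ i, NullSingletonClass (μ i) := fun i => ⟨fun x => hac i (measure_singleton x)⟩
  obtain ⟨t, ⟨hmono, h0, h1⟩, ε, hε⟩ := exists_signedIncrement_eq_zero
    (F := fun i => ProbabilityTheory.cdf (μ i)) (fun i => (ProbabilityTheory.cdf (μ i)).mono)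
    (fun i => continuous_cdf (μ i)) (fun i => by
      rw [← measure_Icc_toReal_eq_cdf_sub (μ i) zero_le_one, hsupp i, ENNReal.toReal_one])
  refine ⟨t, hmono, h0, h1, fun j => if ε j then 1 else -1, fun j => ?_, fun i => ?_⟩
  · by_cases h : ε j = true <;> simp [h]
  · rw [← hε i, signedIncrement]
    refine sum_congr rfl fun j _ => ?_
    rw [measure_Icc_toReal_eq_cdf_sub (μ i) (hmono (Fin.castSucc_le_succ j))]
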